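/- arXiv:2104.02936 — 4 statements merged into one kernel-verified Lean document; each statement's English description precedes it below -/
import Mathlib

section
/- Let N be a finite set of players and ψ : Finset N → ℝ a worth function with ψ(∅) = 0 that is superadditive in the sense that ψ(S ∪ {i}) ≥ ψ(S) + ψ({i}) for every S ⊆ N and every i ∉ S. Then the Shapley value satisfies individual rationality: for every nonempty coalition S ⊆ N and every player i ∈ S, φ_i(S, ψ) ≥ ψ({i}). -/
open Finset

/-- The Shapley value of player `i` in coalition `S` for the worth function `ψ`. -/
noncomputable def shapley {ι : Type*} [DecidableEq ι] (ψ : Finset ι → ℝ)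
    (S : Finset ι) (i : ι) : ℝ :=
  ∑ S1 ∈ S.powerset.filter (fun T => i ∈ T),
    ((Nat.factorial (S.card - S1.card) * Nat.factorial (S1.card - 1) : ℕ) : ℝ)
      / (Nat.factorial S.card : ℝ) * (ψ S1 - ψ (S1.erase i))

theorem shapley_weights_sum {ι : Type*} [DecidableEq ι] (S : Finset ι) (i : ι) (hi : i ∈ S) :
    ∑ S1 ∈ S.powerset.filter (fun T => i ∈ T),
    ((Nat.factorial (S.card - S1.card) * Nat.factorial (S1.card - 1) : ℕ) : ℝ)
      / (Nat.factorial S.card : ℝ) = 1 := by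
  obtain ⟨T, hT, rfl⟩ : ∃ T, i ∉ T ∧ insert i T = S :=
    ⟨S.erase i, by simp, Finset.insert_erase hi⟩
  have h1 : ∑ S1 ∈ (insert i T).powerset.filter (fun T => i ∈ T),
      ((Nat.factorial ((insert i T).card - S1.card) * Nat.factorial (S1.card - 1) : ℕ) : ℝ)
        / (Nat.factorial (insert i T).card : ℝ) =
      ∑ U ∈ T.powerset, ((Nat.factorial (T.card - U.card) * Nat.factorial U.card : ℕ) : ℝ)
        / (Nat.factorial (T.card + 1) : ℝ) := by
    symm
    refine Finset.sum_bij' (fun U _ => insert i U) (fun U _ => U.erase i) ?_ ?_ ?_ ?_ ?_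
    · intro U hU
      simp only [Finset.mem_powerset, Finset.mem_filter] at hU ⊢
      exact ⟨Finset.insert_subset_insert _ hU, Finset.mem_insert_self _ _⟩
    · intro U hU
      simp only [Finset.mem_powerset, Finset.mem_filter] at hU ⊢
      exact Finset.subset_insert_iff.mp hU.1
    · intro U hU
      exact Finset.erase_insert (fun h => hT (Finset.mem_powerset.mp hU h))
    · intro U hU
      exact Finset.insert_erase (Finset.mem_filter.mp hU).2
    · intro U hU
      have : i ∉ U := fun h => hT (Finset.mem_powerset.mp hU h)
      simp [Finset.card_insert_of_notMem this, Finset.card_insert_of_notMem hT]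
  rw [h1, Finset.sum_powerset_apply_card (fun k => ((Nat.factorial (T.card - k) * Nat.factorial k : ℕ) : ℝ)
        / (Nat.factorial (T.card + 1) : ℝ))]
  have h2 : ∀ k ∈ Finset.range (T.card + 1), (T.card.choose k) •
      (((Nat.factorial (T.card - k) * Nat.factorial k : ℕ) : ℝ)
        / (Nat.factorial (T.card + 1) : ℝ)) = 1 / ((T.card : ℝ) + 1) := by
    intro k hk
    have hc := Nat.choose_mul_factorial_mul_factorial (Nat.lt_succ_iff.mp (Finset.mem_range.mp hk))
    have hc' : ((T.card.choose k : ℕ) : ℝ) * (Nat.factorial k : ℝ) * (Nat.factorial (T.card - k) : ℝ)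
        = (Nat.factorial T.card : ℝ) := by exact_mod_cast hc
    have hp : (Nat.factorial T.card : ℝ) ≠ 0 := by positivity
    have hq : (T.card : ℝ) + 1 ≠ 0 := by positivity
    rw [nsmul_eq_mul, Nat.factorial_succ]
    push_cast
    rw [← mul_div_assoc, div_eq_div_iff (mul_ne_zero hq hp) hq, ← hc']
    ring
  rw [Finset.sum_congr rfl h2]
  have hq : (T.card : ℝ) + 1 ≠ 0 := by positivity
  simp [hq]

/-- superadditivity implies individual rationality of the Shapley value. -/
theorem shapley_individual_rationality {ι : Type*} [Fintype ι] [DecidableEq ι]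
    (ψ : Finset ι → ℝ) (hψ0 : ψ ∅ = 0)
    (hsuper : ∀ (S : Finset ι) (i : ι), i ∉ S → ψ (insert i S) ≥ ψ S + ψ {i}) :
    ∀ (S : Finset ι), S.Nonempty → ∀ i ∈ S, shapley ψ S i ≥ ψ {i} := by
  intro S _ i hi
  unfold shapley
  have h := shapley_weights_sum S i hi
  calc ψ {i} = _ := (one_mul _).symm
    _ = _ := by rw [← h, Finset.sum_mul]
    _ ≤ _ := by
      refine Finset.sum_le_sum fun U hU => mul_le_mul_of_nonneg_left ?_ (by positivity)
      have := hsuper (U.erase i) i (by simp)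
      rw [Finset.insert_erase (Finset.mem_filter.mp hU).2] at this
      linarith
end

section
/- Let N be a finite set of players, ψ : Finset N → ℝ a worth function with ψ(∅) = 0, and S ⊆ N a coalition containing a player i. If i is a dummy player, i.e. ψ(S1 ∪ {i}) = ψ(S1) + ψ({i}) for every S1 ⊆ S \ {i}, then the Shapley value awards i exactly her stand-alone worth: φ_i(S, ψ) = ψ({i}). -/
open Finset

/-- a dummy player receives exactly her stand-alone worth. -/
theorem shapley_dummy {ι : Type*} [Fintype ι] [DecidableEq ι]
    (ψ : Finset ι → ℝ) (hψ0 : ψ ∅ = 0) (S : Finset ι) (i : ι) (hi : i ∈ S)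
    (hdummy : ∀ S1 ⊆ S \ {i}, ψ (insert i S1) = ψ S1 + ψ {i}) :
    shapley ψ S i = ψ {i} := by
  have h1 : shapley ψ S i = ∑ A ∈ (S.erase i).powerset,
      ((Nat.factorial ((S.erase i).card - A.card) * Nat.factorial A.card : ℕ) : ℝ)
        / (Nat.factorial S.card : ℝ) * ψ {i} := by
    unfold shapley
    symm
    refine Finset.sum_bij' (fun A _ => insert i A) (fun B _ => B.erase i) ?_ ?_ ?_ ?_ ?_
    · intro A hA
      rw [mem_powerset] at hA
      simp only [mem_filter, mem_powerset, mem_insert_self, and_true]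
      exact insert_subset hi (hA.trans (erase_subset _ _))
    · intro B hB
      simp only [mem_filter, mem_powerset] at hB
      exact mem_powerset.2 (erase_subset_erase _ hB.1)
    · intro A hA
      rw [mem_powerset] at hA
      exact erase_insert (fun h => by simpa using hA h)
    · intro B hB
      exact insert_erase (mem_filter.1 hB).2
    · intro A hA
      rw [mem_powerset] at hA
      have hiA : i ∉ A := fun h => by simpa using hA h
      rw [erase_insert hiA, card_insert_of_notMem hiA, card_erase_of_mem hi,
        hdummy A (by rwa [sdiff_singleton_eq_erase]), add_sub_cancel_left,
        Nat.add_sub_cancel, Nat.sub_sub, Nat.add_comm 1]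
  have hc : S.card = (S.erase i).card + 1 := (card_erase_add_one hi).symm
  rw [h1, hc, ← Finset.sum_mul]
  generalize S.erase i = T
  rw [Finset.sum_powerset_apply_card (fun m =>
    ((Nat.factorial (T.card - m) * Nat.factorial m : ℕ) : ℝ) / (Nat.factorial (T.card + 1) : ℝ))]
  have h2 : ∀ m ∈ range (T.card + 1), T.card.choose m •
      (((Nat.factorial (T.card - m) * Nat.factorial m : ℕ) : ℝ)
        / (Nat.factorial (T.card + 1) : ℝ)) = 1 / ((T.card : ℝ) + 1) := by
    intro m hm
    have hm' : m ≤ T.card := by simpa [Nat.lt_succ_iff] using hm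
    have h3 : ((T.card.choose m : ℝ)) * (Nat.factorial m) * (Nat.factorial (T.card - m))
        = Nat.factorial T.card := by
      exact_mod_cast Nat.choose_mul_factorial_mul_factorial hm'
    have h4 : (Nat.factorial T.card : ℝ) ≠ 0 := by positivity
    have h5 : (T.card : ℝ) + 1 ≠ 0 := by positivity
    rw [nsmul_eq_mul, Nat.factorial_succ]
    push_cast
    rw [← mul_div_assoc, div_eq_div_iff (mul_ne_zero h5 h4) h5]
    linear_combination ((T.card : ℝ) + 1) * h3
  rw [Finset.sum_congr rfl h2]
  have h5 : (T.card : ℝ) + 1 ≠ 0 := by positivity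
  simp [h5]
end

section
/- Let N be a finite set of players with at least two elements and ψ : Finset N → ℝ a worth function with ψ(∅) = 0. The Shapley value satisfies the balanced contributions property: for any two distinct players i, j ∈ N, φ_i(N, ψ) − φ_i(N \ {j}, ψ) = φ_j(N, ψ) − φ_j(N \ {i}, ψ), where φ_i(N \ {j}, ψ) denotes the Shapley value of i in the game obtained by restricting ψ to subsets of N \ {j}. -/
open Finset

theorem shapley_insert_aux {ι : Type*} [DecidableEq ι] (ψ : Finset ι → ℝ)
    (R : Finset ι) (i : ι) (hi : i ∉ R) :
    shapley ψ (insert i R) i = ∑ T ∈ R.powerset,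
      ((Nat.factorial (R.card - T.card) * Nat.factorial T.card : ℕ) : ℝ)
      / (Nat.factorial (R.card + 1) : ℝ) * (ψ (insert i T) - ψ T) := by
  unfold shapley
  symm
  refine Finset.sum_bij' (fun T _ => insert i T) (fun T _ => T.erase i) ?_ ?_ ?_ ?_ ?_
  · intro T hT
    simp only [mem_powerset, mem_filter] at hT ⊢
    exact ⟨insert_subset_insert i hT, mem_insert_self i T⟩
  · intro T hT
    simp only [mem_powerset, mem_filter] at hT ⊢
    exact subset_insert_iff.mp hT.1
  · intro T hT
    exact erase_insert (fun h => hi (mem_powerset.mp hT h))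
  · intro T hT
    exact insert_erase (mem_filter.mp hT).2
  · intro T hT
    have h : i ∉ T := fun h => hi (mem_powerset.mp hT h)
    rw [erase_insert h, card_insert_of_notMem h, card_insert_of_notMem hi,
      Nat.add_sub_add_right, Nat.add_sub_cancel]

theorem shapley_diff_aux {ι : Type*} [DecidableEq ι] (ψ : Finset ι → ℝ)
    (R : Finset ι) (i j : ι) (hij : i ≠ j) (hi : i ∉ R) (hj : j ∉ R) :
    shapley ψ (insert i (insert j R)) i - shapley ψ (insert i R) i = ∑ T ∈ R.powerset,
      ((Nat.factorial (R.card - T.card) * Nat.factorial (T.card + 1) : ℕ) : ℝ)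
      / (Nat.factorial (R.card + 2) : ℝ) *
      (ψ (insert i (insert j T)) - ψ (insert i T) - ψ (insert j T) + ψ T) := by
  rw [shapley_insert_aux ψ _ i (by simp [hij, hi]), shapley_insert_aux ψ R i hi,
    sum_powerset_insert hj, ← sum_add_distrib, ← sum_sub_distrib]
  refine sum_congr rfl fun T hT => ?_
  have hT := mem_powerset.mp hT
  have h : j ∉ T := fun h => hj (hT h)
  obtain ⟨d, hd⟩ := Nat.exists_eq_add_of_le (card_le_card hT)
  rw [card_insert_of_notMem h, card_insert_of_notMem hj, hd]
  rw [show #T + d + 1 - #T = d + 1 by omega, show #T + d + 1 - (#T + 1) = d by omega,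
    show #T + d - #T = d by omega]
  have h1 : ((#T + d).factorial : ℝ) ≠ 0 := by positivity
  have h2 : ((#T : ℝ) + d + 1) ≠ 0 := by positivity
  have h3 : ((#T : ℝ) + d + 1 + 1) ≠ 0 := by positivity
  simp only [Nat.factorial_succ]
  push_cast
  field_simp
  ring

/-- the Shapley value satisfies the balanced contributions property. -/
theorem shapley_balanced_contributions {ι : Type*} [Fintype ι] [DecidableEq ι]
    (hcard : 2 ≤ Fintype.card ι)
    (ψ : Finset ι → ℝ) (hψ0 : ψ ∅ = 0) (i j : ι) (hij : i ≠ j) :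
    shapley ψ Finset.univ i - shapley ψ (Finset.univ.erase j) i =
      shapley ψ Finset.univ j - shapley ψ (Finset.univ.erase i) j := by
  have key : ∀ a b : ι, a ≠ b → Finset.univ = insert a (insert b ((Finset.univ.erase a).erase b)) := by
    intro a b hab
    ext x
    simp only [mem_univ, mem_insert, mem_erase, true_iff]
    tauto
  have e1 : (Finset.univ.erase j : Finset ι) = insert i ((Finset.univ.erase i).erase j) := by
    ext x
    simp only [mem_univ, mem_insert, mem_erase]
    grind
  have e2 : (Finset.univ.erase i : Finset ι) = insert j ((Finset.univ.erase i).erase j) := by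
    ext x
    simp only [mem_univ, mem_insert, mem_erase]
    grind
  have hu := key i j hij
  generalize hR : (Finset.univ.erase i).erase j = R at hu e1 e2
  have hi : i ∉ R := by simp [← hR]
  have hj : j ∉ R := by simp [← hR]
  rw [e1, e2, hu, shapley_diff_aux ψ R i j hij hi hj, Finset.insert_comm i j R,
    shapley_diff_aux ψ R j i hij.symm hj hi]
  refine sum_congr rfl fun T _ => ?_
  rw [Finset.insert_comm i j T]
  ring
end

section
/- Let N be a finite set of n ≥ 1 players and ψ : Finset N → ℝ a worth function with ψ(∅) = 0. For every i ∈ N, the Shapley value equals the average over all orderings of the players of the marginal contribution of i to the set of players preceding it: φ_i(N, ψ) = (1/n!) · Σ_{σ : Fin n ≃ N} (ψ(P_σ(i) ∪ {i}) − ψ(P_σ(i))), where the sum ranges over all bijections σ from Fin n to N and P_σ(i) = { σ(k) : k < σ⁻¹(i) } is the set of players that precede i in the ordering σ. -/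
open Finset

/-- The set of players preceding `i` in the ordering `σ`. -/
def predSet {ι : Type*} [DecidableEq ι] {n : ℕ} [Fintype ι] (σ : Fin n ≃ ι) (i : ι) :
    Finset ι :=
  (Finset.univ.filter (fun k : Fin n => k < σ.symm i)).image σ


theorem mem_predSet_aux {ι : Type*} [Fintype ι] [DecidableEq ι] {n : ℕ} (σ : Fin n ≃ ι) (i a : ι) :
    a ∈ predSet σ i ↔ σ.symm a < σ.symm i := by
  unfold predSet
  simp only [Finset.mem_image, Finset.mem_filter, Finset.mem_univ, true_and]
  constructor
  · rintro ⟨k, hk, rfl⟩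
    simpa using hk
  · intro h
    exact ⟨σ.symm a, h, by simp⟩

theorem card_predSet_aux {ι : Type*} [Fintype ι] [DecidableEq ι] {n : ℕ} (σ : Fin n ≃ ι) (i : ι) :
    (predSet σ i).card = (σ.symm i : ℕ) := by
  unfold predSet
  rw [Finset.card_image_of_injective _ σ.injective]
  have : (Finset.univ.filter (fun k : Fin n => k < σ.symm i)) = Finset.Iio (σ.symm i) := by
    ext; simp
  rw [this, Fin.card_Iio]

def colD {ι : Type*} [DecidableEq ι] (T : Finset ι) (i a : ι) : Fin 3 :=
  if a = i then 1 else if a ∈ T then 0 else 2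

def colC {n : ℕ} (m k : Fin n) : Fin 3 :=
  if k = m then 1 else if k < m then 0 else 2

theorem colD_card {ι : Type*} [Fintype ι] [DecidableEq ι] (T : Finset ι) (i : ι) (hi : i ∈ T)
    (j : Fin 3) : Fintype.card {a // colD T i a = j} =
      if j = 0 then T.card - 1 else if j = 1 then 1 else Fintype.card ι - T.card := by
  rw [Fintype.card_subtype]
  fin_cases j
  · have : (univ.filter fun a => colD T i a = 0) = T.erase i := by
      ext a; simp only [colD, mem_filter, mem_univ, true_and, mem_erase]; grind
    simp [this, Finset.card_erase_of_mem hi]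
  · have : (univ.filter fun a => colD T i a = 1) = {i} := by
      ext a; simp only [colD, mem_filter, mem_univ, true_and, mem_singleton]; grind
    simp [this]
  · have : (univ.filter fun a => colD T i a = 2) = Tᶜ := by
      ext a; simp only [colD, mem_filter, mem_univ, true_and, mem_compl]; grind
    simp [this, Finset.card_compl]

theorem colC_card {n : ℕ} (m : Fin n) 
    (j : Fin 3) : Fintype.card {a // colC m a = j} =
      if j = 0 then (m : ℕ) else if j = 1 then 1 else n - (m + 1) := by
  rw [Fintype.card_subtype]
  fin_cases j
  · have : (univ.filter fun a => colC m a = 0) = Iio m := by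
      ext a; simp only [colC, mem_filter, mem_univ, true_and, mem_Iio]; grind
    simp [this]
  · have : (univ.filter fun a => colC m a = 1) = {m} := by
      ext a; simp only [colC, mem_filter, mem_univ, true_and, mem_singleton]; grind
    simp [this]
  · have : (univ.filter fun a => colC m a = 2) = Ioi m := by
      ext a; simp only [colC, mem_filter, mem_univ, true_and, mem_Ioi]; grind
    simp [this]
    omega

theorem insert_predSet_iff {ι : Type*} [Fintype ι] [DecidableEq ι] {n : ℕ}
    (T : Finset ι) (i : ι) (hi : i ∈ T) (m : Fin n) (hm : (m : ℕ) + 1 = T.card) (σ : Fin n ≃ ι) :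
    insert i (predSet σ i) = T ↔ ∀ k, colD T i (σ k) = colC m k := by
  constructor
  · intro h k
    have hni : i ∉ predSet σ i := by simp [mem_predSet_aux]
    have hc := congrArg Finset.card h
    rw [Finset.card_insert_of_notMem hni, card_predSet_aux] at hc
    have hmi : σ.symm i = m := by ext; omega
    have h1 : σ k = i ↔ k = m := by rw [← hmi, Equiv.eq_symm_apply]
    have h2 : σ k ∈ T ↔ σ k = i ∨ k < m := by
      rw [← h, Finset.mem_insert, mem_predSet_aux, hmi]; simp
    simp only [colD, colC, h1, h2]
    grind
  · intro h
    have h1 : σ m = i := by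
      have := h m
      simp only [colD, colC] at this
      grind
    have hmi : σ.symm i = m := by rw [← h1]; simp
    ext a
    have h2 := h (σ.symm a)
    rw [Finset.mem_insert, mem_predSet_aux, hmi]
    have h3 : σ.symm a = m ↔ a = i := by rw [← hmi]; simp
    simp only [colD, colC, Equiv.apply_symm_apply, h3] at h2
    grind

theorem card_orderings {ι : Type*} [Fintype ι] [DecidableEq ι] {n : ℕ}
    (hcard : Fintype.card ι = n) (T : Finset ι) (i : ι) (hi : i ∈ T) :
    (univ.filter fun σ : Fin n ≃ ι => insert i (predSet σ i) = T).card =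
      Nat.factorial (n - T.card) * Nat.factorial (T.card - 1) := by
  have hpos : 0 < T.card := Finset.card_pos.2 ⟨i, hi⟩
  have hle : T.card ≤ n := hcard ▸ Finset.card_le_univ T
  obtain ⟨m, hm⟩ : ∃ m : Fin n, (m : ℕ) + 1 = T.card := ⟨⟨T.card - 1, by omega⟩, by simp; omega⟩
  have hfib : ∀ j, Fintype.card {a // colC m a = j} = Fintype.card {a // colD T i a = j} := by
    intro j
    rw [colC_card, colD_card T i hi, hcard, ← hm]
    simp
  let σ₀ : Fin n ≃ ι := Equiv.ofFiberEquiv (fun j => Fintype.equivOfCardEq (hfib j))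
  have hσ₀ : ∀ k, colD T i (σ₀ k) = colC m k := fun k => Equiv.ofFiberEquiv_map _ k
  have hst := DomMulAct.stabilizer_card (colD T i)
  rw [Fin.prod_univ_three] at hst
  simp only [colD_card T i hi, hcard] at hst
  rw [← Fintype.card_subtype]
  have : Fintype.card {σ : Fin n ≃ ι // insert i (predSet σ i) = T} =
      Fintype.card {g : Equiv.Perm ι // colD T i ∘ g = colD T i} := by
    refine Fintype.card_congr (Equiv.subtypeEquiv (Equiv.equivCongr σ₀ (Equiv.refl ι)) ?_)
    intro σ
    rw [insert_predSet_iff T i hi m hm, funext_iff]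
    constructor
    · intro h a
      have := h (σ₀.symm a)
      rw [← hσ₀] at this
      simpa using this
    · intro h k
      have := h (σ₀ k)
      rw [hσ₀] at this
      simpa using this
  rw [this, hst]
  simp [mul_comm]

/-- the Shapley value is the average, over all orderings of the players, of
the marginal contribution of the player to the set of players preceding it. -/
theorem shapley_eq_average_marginal_contribution {ι : Type*} [Fintype ι] [DecidableEq ι]
    (n : ℕ) (hn : 1 ≤ n) (hcard : Fintype.card ι = n)
    (ψ : Finset ι → ℝ) (hψ0 : ψ ∅ = 0) (i : ι) :
    shapley ψ Finset.univ i =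
      (1 / (Nat.factorial n : ℝ)) *
        ∑ σ : Fin n ≃ ι, (ψ (insert i (predSet σ i)) - ψ (predSet σ i)) := by
  have key : ∀ σ : Fin n ≃ ι, ψ (insert i (predSet σ i)) - ψ (predSet σ i) =
      (fun T => ψ T - ψ (T.erase i)) (insert i (predSet σ i)) := by
    intro σ
    have hni : i ∉ predSet σ i := by simp [mem_predSet_aux]
    simp [Finset.erase_insert hni]
  rw [Finset.sum_congr rfl (fun σ _ => key σ)]
  rw [← Finset.sum_fiberwise_of_maps_to
    (t := (univ : Finset ι).powerset.filter (fun T => i ∈ T))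
    (g := fun σ : Fin n ≃ ι => insert i (predSet σ i)) (by intro σ _; simp)]
  unfold shapley
  rw [Finset.mul_sum]
  refine Finset.sum_congr rfl fun T hT => ?_
  have hi : i ∈ T := (Finset.mem_filter.1 hT).2
  rw [Finset.sum_congr rfl (g := fun _ => ψ T - ψ (T.erase i))
    (fun σ hσ => by rw [(Finset.mem_filter.1 hσ).2])]
  rw [Finset.sum_const, card_orderings hcard T i hi, Finset.card_univ, hcard, nsmul_eq_mul]
  ring
end
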